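/- The complete bipartite graph K₃,₃ does not embed topologically into the plane ℝ². -/

import Mathlib

open Set

noncomputable section

/-- The point of `ℝ^V` corresponding to a vertex `v` of a graph. -/
def vert {V : Type*} [DecidableEq V] (v : V) : V → ℝ := fun i => if i = v then 1 else 0

/-- Geometric realization of a simple graph as a subset of `ℝ^V`:
the union of the straight segments joining the standard points of adjacent vertices. -/
def graphRealization {V : Type*} [DecidableEq V] (G : SimpleGraph V) : Set (V → ℝ) :=
  ⋃ p : {p : V × V // G.Adj p.1 p.2}, segment ℝ (vert p.1.1) (vert p.1.2)

/-- A (compact) polyhedron: a finite union of polytopes (convex hulls of finite sets). -/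
def IsPolyhedron {E : Type*} [AddCommGroup E] [Module ℝ E] (s : Set E) : Prop :=
  ∃ T : Set (Set E), T.Finite ∧ (∀ P ∈ T, ∃ Q : Set E, Q.Finite ∧ P = convexHull ℝ Q) ∧
    s = ⋃₀ T

/-- `f` is piecewise linear (PL) on `s`: there is a finite family of polytopes covering `s`
on each of which `f` coincides with an affine map. -/
def IsPLOn {E F : Type*} [AddCommGroup E] [Module ℝ E] [AddCommGroup F] [Module ℝ F]
    (f : E → F) (s : Set E) : Prop :=
  ∃ T : Set (Set E), T.Finite ∧ (∀ P ∈ T, ∃ Q : Set E, Q.Finite ∧ P = convexHull ℝ Q) ∧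
    s ⊆ ⋃₀ T ∧ ∀ P ∈ T, ∃ g : E →ᵃ[ℝ] F, EqOn f g (P ∩ s)

/-- The cone over a set `A` with apex `p` (union of segments from `p` to points of `A`). -/
def coneFrom {E : Type*} [AddCommGroup E] [Module ℝ E] (p : E) (A : Set E) : Set E :=
  ⋃ x ∈ A, segment ℝ p x

/-- A nowhere vanishing continuous function on a simply connected, locally path connected space
has a continuous logarithm. -/
theorem exists_continuous_exp_eq {X : Type*} [TopologicalSpace X] [SimplyConnectedSpace X]
    [LocallyPathConnectedSpace X] {g : X → ℂ} (hg : Continuous g) (h0 : ∀ x, g x ≠ 0) :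
    ∃ h : X → ℂ, Continuous h ∧ ∀ x, Complex.exp (h x) = g x := by
  obtain ⟨x₀⟩ : Nonempty X := inferInstance
  obtain ⟨h, ⟨-, hh⟩, -⟩ := Complex.isCoveringMapOn_exp.existsUnique_continuousMap_lifts
    ⟨g, hg⟩ (a₀ := x₀) (Complex.exp_log (h0 x₀)) h0
  exact ⟨h, h.continuous, congrFun hh⟩

/-- Two continuous functions whose exponentials are proportional differ by a constant. -/
theorem sub_eq_sub_of_exp_eq_mul {X : Type*} [TopologicalSpace X] [PreconnectedSpace X]
    {g h : X → ℂ} (hg : Continuous g) (hh : Continuous h) {c : ℂ}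
    (hc : ∀ x, Complex.exp (g x) = c * Complex.exp (h x)) (x y : X) :
    g x - g y = h x - h y := by
  have key : g = fun x => h x + (g y - h y) := by
    refine Complex.isCoveringMap_exp.eq_of_comp_eq hg (by fun_prop) ?_ y (by ring)
    funext x
    apply Subtype.ext
    simp only [Function.comp_apply, Complex.exp_add, Complex.exp_sub, hc]
    field_simp
  linear_combination congrFun key x

/-- The increment over `[0, 1]` of a continuous logarithm of a nowhere vanishing path. -/
theorem exists_log_increment {g : ℝ → ℂ} (hg : Continuous g) (h0 : ∀ t, g t ≠ 0) :
    ∃ δ : ℂ, Complex.exp δ * g 0 = g 1 ∧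
      ∀ (h : ℝ → ℂ) (c : ℂ), Continuous h → (∀ t, Complex.exp (h t) = c * g t) →
        h 1 - h 0 = δ := by
  obtain ⟨l, hl, hlg⟩ := exists_continuous_exp_eq hg h0
  refine ⟨l 1 - l 0, ?_, fun h c hh hc =>
    sub_eq_sub_of_exp_eq_mul hh hl (c := c) (fun t => by rw [hc, hlg]) 1 0⟩
  rw [← hlg 0, ← hlg 1, ← Complex.exp_add]
  congr 1
  ring

/-- Logarithms of the differences of distinct points, where swapping the two points changes the
logarithm by `π * I`. -/
theorem exists_log_sub {ι : Type*} [LinearOrder ι] {a : ι → ℂ} (ha : Function.Injective a) :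
    ∃ L : ι → ι → ℂ, (∀ i k, i ≠ k → Complex.exp (L i k) = a i - a k) ∧
      ∀ i k, i < k → L k i = L i k + Real.pi * Complex.I := by
  refine ⟨fun i k => if i < k then Complex.log (a i - a k)
    else Complex.log (a k - a i) + Real.pi * Complex.I, fun i k hik => ?_, fun i k hik => ?_⟩
  · have h1 : a i - a k ≠ 0 := sub_ne_zero.2 (ha.ne hik)
    have h2 : a k - a i ≠ 0 := sub_ne_zero.2 (ha.ne hik.symm)
    dsimp only
    split_ifs
    · exact Complex.exp_log h1
    · rw [Complex.exp_add, Complex.exp_log h2, Complex.exp_pi_mul_I]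
      ring
  · simp [hik, hik.not_gt]

/-- In any drawing of `K₃,₃` in `ℂ`, two disjoint edges meet. -/
theorem exists_disjoint_edges_meet (a b : Fin 3 → ℂ) (e : Fin 3 → Fin 3 → ℝ → ℂ)
    (he : ∀ i j, Continuous (e i j)) (he0 : ∀ i j, e i j 0 = a i) (he1 : ∀ i j, e i j 1 = b j) :
    ∃ i j k l s t, i ≠ k ∧ j ≠ l ∧ e i j s = e k l t := by
  by_contra! hd
  have haa : Function.Injective a := fun i k h => by
    by_contra hik
    exact hd i 0 k 1 0 0 hik (by decide) (by rw [he0, he0, h])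
  have hbb : Function.Injective b := fun j l h => by
    by_contra hjl
    exact hd 0 j 1 l 1 1 (by decide) hjl (by rw [he1, he1, h])
  have hae : ∀ i k l, i ≠ k → ∀ t, a i - e k l t ≠ 0 := fun i k l hik t => by
    obtain ⟨j, hj⟩ := exists_ne l
    exact sub_ne_zero.2 (he0 i j ▸ hd i j k l 0 t hik hj)
  have hbe : ∀ j k l, j ≠ l → ∀ t, b j - e k l t ≠ 0 := fun j k l hjl t => by
    obtain ⟨i, hi⟩ := exists_ne k
    exact sub_ne_zero.2 (he1 i j ▸ hd i j k l 1 t hi hjl)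
  have hab : ∀ i j, a i - b j ≠ 0 := fun i j => by
    obtain ⟨k, hk⟩ := exists_ne i
    exact he1 k j ▸ hae i k j hk.symm 1
  choose! α hα hα' using fun i k l (hik : i ≠ k) =>
    exists_log_increment (continuous_const.sub (he k l)) (hae i k l hik)
  choose! β hβ hβ' using fun j k l (hjl : j ≠ l) =>
    exists_log_increment (continuous_const.sub (he k l)) (hbe j k l hjl)
  -- A logarithm of `e i j s - e k l t` on the square shows that the increments around its
  -- boundary cancel.
  have square : ∀ i j k l, i ≠ k → j ≠ l → α i k l + β l i j = α k i j + β j k l := by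
    intro i j k l hik hjl
    obtain ⟨G, hG, hGe⟩ := exists_continuous_exp_eq (X := ℝ × ℝ)
      (g := fun p => e i j p.1 - e k l p.2)
      (((he i j).comp continuous_fst).sub ((he k l).comp continuous_snd))
      fun p => sub_ne_zero.2 (hd i j k l p.1 p.2 hik hjl)
    have h1 := hα' i k l hik (fun t => G (0, t)) 1 (by fun_prop) (by simp [hGe, he0])
    have h2 := hβ' j k l hjl (fun t => G (1, t)) 1 (by fun_prop) (by simp [hGe, he1])
    have h3 := hα' k i j hik.symm (fun t => G (t, 0)) (-1) (by fun_prop) (by simp [hGe, he0])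
    have h4 := hβ' l i j hjl.symm (fun t => G (t, 1)) (-1) (by fun_prop) (by simp [hGe, he1])
    rw [← h1, ← h2, ← h3, ← h4]
    ring
  obtain ⟨A, hA, hA'⟩ := exists_log_sub haa
  obtain ⟨B, hB, hB'⟩ := exists_log_sub hbb
  have hn : ∀ i k l, i ≠ k → ∃ n : ℤ,
      α i k l + A i k = Complex.log (a i - b l) + n * (2 * Real.pi * Complex.I) := by
    intro i k l hik
    rw [← Complex.exp_eq_exp_iff_exists_int, Complex.exp_add, hA i k hik,
      Complex.exp_log (hab i l), ← he0 k l, ← he1 k l]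
    exact hα i k l hik
  have hm : ∀ j k l, j ≠ l → ∃ m : ℤ,
      β j k l + (Complex.log (a k - b j) + Real.pi * Complex.I) =
        B j l + m * (2 * Real.pi * Complex.I) := by
    intro j k l hjl
    rw [← Complex.exp_eq_exp_iff_exists_int, Complex.exp_add, Complex.exp_add, hB j l hjl,
      Complex.exp_log (hab k j), Complex.exp_pi_mul_I, ← he0 k l, ← he1 k l]
    have h : Complex.exp (β j k l) * (b j - e k l 0) = b j - e k l 1 := hβ j k l hjl
    linear_combination h
  choose! n hn using hn
  choose! m hm using hm
  have hpi : (2 * Real.pi * Complex.I : ℂ) ≠ 0 := Complex.two_pi_I_ne_zero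
  have parity₁ : ∀ i j k l, i < k → j < l →
      n i k l + m l i j - n k i j - m j k l = -1 := by
    intro i j k l hik hjl
    have : ((n i k l + m l i j - n k i j - m j k l : ℤ) : ℂ) = (-1 : ℤ) := by
      apply mul_right_cancel₀ hpi
      push_cast
      linear_combination square i j k l hik.ne hjl.ne - hn i k l hik.ne + hn k i j hik.ne'
        - hm l i j hjl.ne' + hm j k l hjl.ne - hA' i k hik - hB' j l hjl
    exact_mod_cast this
  have parity₂ : ∀ i j k l, i < k → l < j →
      n i k l + m l i j - n k i j - m j k l = 0 := by
    intro i j k l hik hjl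
    have : ((n i k l + m l i j - n k i j - m j k l : ℤ) : ℂ) = (0 : ℤ) := by
      apply mul_right_cancel₀ hpi
      push_cast
      linear_combination square i j k l hik.ne hjl.ne' - hn i k l hik.ne + hn k i j hik.ne'
        - hm l i j hjl.ne + hm j k l hjl.ne' - hA' i k hik + hB' l j hjl
    exact_mod_cast this
  -- Modulo 2, each unknown occurs twice in the sum of the 18 equations, 9 of which are odd.
  simp [Fin.forall_fin_succ] at parity₁ parity₂
  omega

/-- The segment joining two adjacent vertices, parametrized by time clamped to `[0, 1]`, lies in
the realization of the graph. -/
theorem mem_graphRealization_lineMap {V : Type*} [DecidableEq V] {G : SimpleGraph V} {v w : V}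
    (h : G.Adj v w) (t : ℝ) :
    AffineMap.lineMap (vert v) (vert w) (projIcc (0 : ℝ) 1 zero_le_one t : ℝ) ∈
      graphRealization G := by
  refine mem_iUnion.2 ⟨⟨(v, w), h⟩, ?_⟩
  rw [segment_eq_image_lineMap]
  exact mem_image_of_mem _ (projIcc (0 : ℝ) 1 zero_le_one t).2

/-- The complete bipartite graph `K₃,₃` does not embed topologically into the plane `ℝ²`. -/
theorem K33_not_planar :
    ¬ ∃ f : ↥(graphRealization (completeBipartiteGraph (Fin 3) (Fin 3))) →
        EuclideanSpace ℝ (Fin 2),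
      Continuous f ∧ Function.Injective f := by
  rintro ⟨f, hf, hinj⟩
  have hadj : ∀ i j : Fin 3, (completeBipartiteGraph (Fin 3) (Fin 3)).Adj (.inl i) (.inr j) := by
    simp
  let φ := Complex.orthonormalBasisOneI.repr.symm
  let e : Fin 3 → Fin 3 → ℝ → ℂ := fun i j t =>
    φ (f ⟨_, mem_graphRealization_lineMap (hadj i j) t⟩)
  obtain ⟨i, j, k, l, s, t, hik, hjl, h⟩ := exists_disjoint_edges_meet
    (fun i => e i 0 0) (fun j => e 0 j 1) e
    (fun i j => φ.continuous.comp <| hf.comp <| Continuous.subtype_mk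
      (AffineMap.lineMap_continuous.comp (continuous_subtype_val.comp continuous_projIcc)) _)
    (fun i j => by simp [e]) (fun i j => by simp [e])
  have h := congrArg Subtype.val (hinj (φ.injective h))
  have h1 := congrFun h (.inl i)
  have h2 := congrFun h (.inr j)
  simp [AffineMap.lineMap_apply, vert, hik, hjl] at h1 h2
  simp [projIcc_of_le_left _ h2] at h1
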